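/- arXiv:1310.7919 — 8 statements merged into one kernel-verified Lean document; each statement's English description precedes it below -/
import Mathlib

section
/- Fix nonnegative reals λ∅, λ1, λ2, λ12 with λ∅ + λ1 + λ2 + λ12 = 1, λ1 + λ12 > 0 and λ2 + λ12 > 0. Set c1 = 1−(λ2+λ12), c2 = 1−(λ1+λ12), and define π on pairs of positive integers by: π(i,i) = λ∅^{i−1}λ12; π(i,j) = λ∅^{j−1}λ2·c2^{i−j−1}(1−c2) if i > j; π(i,j) = λ∅^{i−1}λ1·c1^{j−i−1}(1−c1) if i < j. Then π is a probability distribution: Σ_{i≥1} Σ_{j≥1} π(i,j) = 1. -/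
/-- The stationary joint distribution of the ages of information `(A1, A2)` in a star
gossip network with one source and two receivers. Here `c1 = 1 - (l2 + l12)` and
`c2 = 1 - (l1 + l12)`. -/
noncomputable def starPi (l0 l1 l2 l12 : ℝ) (i j : ℕ+) : ℝ :=
  if i = j then l0 ^ ((i : ℕ) - 1) * l12
  else if j < i then
    l0 ^ ((j : ℕ) - 1) * l2 * (1 - (l1 + l12)) ^ ((i : ℕ) - (j : ℕ) - 1) * (l1 + l12)
  else
    l0 ^ ((i : ℕ) - 1) * l1 * (1 - (l2 + l12)) ^ ((j : ℕ) - (i : ℕ) - 1) * (l2 + l12)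

theorem PNat.hasSum_iff_succPNat {f : ℕ+ → ℝ} {a : ℝ} :
    HasSum f a ↔ HasSum (fun n : ℕ => f n.succPNat) a :=
  (Equiv.pnatEquivNat.symm.hasSum_iff (f := f)).symm

theorem hasSum_geometric_convolution {x y : ℝ} (hx0 : 0 ≤ x) (hx : x < 1) (hy0 : 0 ≤ y)
    (hy : y < 1) :
    HasSum (fun m : ℕ => ∑ k ∈ Finset.range m, x ^ k * y ^ (m - 1 - k))
      ((1 - x)⁻¹ * (1 - y)⁻¹) := by
  rw [← hasSum_nat_add_iff' 1]
  have h := hasSum_sum_range_mul_of_summable_norm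
    (summable_geometric_of_lt_one hx0 hx).norm (summable_geometric_of_lt_one hy0 hy).norm
  simpa [tsum_geometric_of_lt_one hx0 hx, tsum_geometric_of_lt_one hy0 hy] using h

theorem hasSum_starPi_row {l0 l1 l2 l12 : ℝ} (hc : 0 ≤ 1 - (l2 + l12))
    (hpos : 0 < l2 + l12) (m : ℕ) :
    HasSum (fun j : ℕ+ => starPi l0 l1 l2 l12 m.succPNat j)
      (l0 ^ m * (l1 + l12) + l2 * (l1 + l12) *
        ∑ k ∈ Finset.range m, l0 ^ k * (1 - (l1 + l12)) ^ (m - 1 - k)) := by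
  rw [PNat.hasSum_iff_succPNat, ← hasSum_nat_add_iff' (m + 1), Finset.sum_range_succ]
  have hlt : ∀ k ∈ Finset.range m, starPi l0 l1 l2 l12 m.succPNat k.succPNat =
      l2 * (l1 + l12) * (l0 ^ k * (1 - (l1 + l12)) ^ (m - 1 - k)) := by
    intro k hk
    have hkm : k < m := Finset.mem_range.mp hk
    have e : m + 1 - (k + 1) - 1 = m - 1 - k := by omega
    simp only [starPi, Nat.succPNat_inj, Nat.succPNat_lt_succPNat, hkm.ne', hkm, if_true,
      if_false, Nat.succPNat_coe, Nat.succ_eq_add_one, Nat.add_sub_cancel, e]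
    ring
  have hgt : ∀ n : ℕ, starPi l0 l1 l2 l12 m.succPNat (n + (m + 1)).succPNat =
      l0 ^ m * l1 * (l2 + l12) * (1 - (l2 + l12)) ^ n := by
    intro n
    have hne : m ≠ n + (m + 1) := by omega
    have hnlt : ¬ n + (m + 1) < m := by omega
    have e : n + (m + 1) + 1 - (m + 1) - 1 = n := by omega
    simp only [starPi, Nat.succPNat_inj, Nat.succPNat_lt_succPNat, hne, hnlt,
      if_false, Nat.succPNat_coe, Nat.succ_eq_add_one, Nat.add_sub_cancel, e]
    ring
  have hdiag : starPi l0 l1 l2 l12 m.succPNat m.succPNat = l0 ^ m * l12 := by simp [starPi]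
  rw [Finset.sum_congr rfl hlt, ← Finset.mul_sum, hdiag]
  simp only [hgt]
  convert (hasSum_geometric_of_lt_one hc (by linarith)).mul_left (l0 ^ m * l1 * (l2 + l12))
    using 1
  · rfl
  rw [sub_sub_cancel, mul_inv_cancel_right₀ hpos.ne']
  ring

/-- The stationary joint distribution of the two ages in the two-receiver star network is a
probability distribution: it sums to `1`. -/
theorem starPi_sums_to_one (l0 l1 l2 l12 : ℝ)
    (h0 : 0 ≤ l0) (h1 : 0 ≤ l1) (h2 : 0 ≤ l2) (h12 : 0 ≤ l12)
    (hsum : l0 + l1 + l2 + l12 = 1) (hpos1 : 0 < l1 + l12) (hpos2 : 0 < l2 + l12) :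
    ∑' (i : ℕ+) (j : ℕ+), starPi l0 l1 l2 l12 i j = 1 := by
  have hl0 : l0 < 1 := by linarith
  have hc1 : 0 ≤ 1 - (l2 + l12) := by linarith
  have hc2 : 0 ≤ 1 - (l1 + l12) := by linarith
  refine HasSum.tsum_eq (PNat.hasSum_iff_succPNat.mpr ?_)
  simp only [(hasSum_starPi_row hc1 hpos2 _).tsum_eq]
  convert ((hasSum_geometric_of_lt_one h0 hl0).mul_right (l1 + l12)).add
    ((hasSum_geometric_convolution h0 hl0 hc2 (by linarith)).mul_left (l2 * (l1 + l12))) using 1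
  · rfl
  have hne : 1 - l0 ≠ 0 := by linarith
  rw [sub_sub_cancel]
  field_simp
  linarith
end

section
/- Fix nonnegative reals λ∅, λ1, λ2, λ12 with λ∅ + λ1 + λ2 + λ12 = 1, λ1 + λ12 > 0 and λ2 + λ12 > 0. Set c1 = 1−(λ2+λ12), c2 = 1−(λ1+λ12), and define π on pairs of positive integers by: π(i,i) = λ∅^{i−1}λ12; π(i,j) = λ∅^{j−1}λ2·c2^{i−j−1}(1−c2) if i > j; π(i,j) = λ∅^{i−1}λ1·c1^{j−i−1}(1−c1) if i < j. Then the first marginal of π is geometric: for every i ≥ 1, Σ_{j≥1} π(i,j) = (1−c2)·c2^{i−1} = (λ1+λ12)(1−(λ1+λ12))^{i−1}. -/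
/-- The geometric masses `r ^ k * (1 - r)` sum to one. -/
theorem hasSum_one_sub_mul_geometric {r : ℝ} (hr0 : 0 ≤ r) (hr1 : r < 1) :
    HasSum (fun k : ℕ => r ^ k * (1 - r)) 1 := by
  have h := (hasSum_geometric_of_lt_one hr0 hr1).mul_right (1 - r)
  rwa [inv_mul_cancel₀ (sub_pos.mpr hr1).ne'] at h

/-- The row `i = n + 1` of `starPi`, summed over its entries below the diagonal. -/
theorem sum_range_starPi_succ {l0 l1 l2 l12 : ℝ} (hsum : l0 + l1 + l2 + l12 = 1) (n : ℕ) :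
    ∑ k ∈ Finset.range n, starPi l0 l1 l2 l12 n.succPNat k.succPNat =
      ((1 - (l1 + l12)) ^ n - l0 ^ n) * (l1 + l12) := by
  have hterm : ∀ k ∈ Finset.range n, starPi l0 l1 l2 l12 n.succPNat k.succPNat =
      l0 ^ k * (1 - (l1 + l12)) ^ (n - 1 - k) * (l2 * (l1 + l12)) := by
    intro k hk
    have hk : k < n := Finset.mem_range.mp hk
    have hne : n.succPNat ≠ k.succPNat := fun h => hk.ne' (Nat.succPNat_injective h)
    have hlt : k.succPNat < n.succPNat := Nat.succPNat_lt_succPNat.mpr hk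
    have hexp : n + 1 - (k + 1) - 1 = n - 1 - k := by omega
    simp only [starPi, if_neg hne, if_pos hlt, Nat.succPNat_coe, Nat.succ_eq_add_one,
      Nat.add_sub_cancel, hexp]
    ring
  rw [Finset.sum_congr rfl hterm, ← Finset.sum_mul]
  have h := (Commute.all l0 (1 - (l1 + l12))).geom_sum₂_mul n
  have hl2 : l2 = -(l0 - (1 - (l1 + l12))) := by linarith
  calc _ = -((∑ k ∈ Finset.range n, l0 ^ k * (1 - (l1 + l12)) ^ (n - 1 - k)) *
        (l0 - (1 - (l1 + l12)))) * (l1 + l12) := by rw [hl2]; ring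
    _ = _ := by rw [h]; ring

/-- The row `i = n + 1` of `starPi` sums to the geometric mass at `n + 1`. -/
theorem hasSum_starPi_succ {l0 l1 l2 l12 : ℝ} (h0 : 0 ≤ l0) (h1 : 0 ≤ l1)
    (hsum : l0 + l1 + l2 + l12 = 1) (hpos2 : 0 < l2 + l12) (n : ℕ) :
    HasSum (fun k : ℕ => starPi l0 l1 l2 l12 n.succPNat k.succPNat)
      ((l1 + l12) * (1 - (l1 + l12)) ^ n) := by
  have hterm : ∀ k : ℕ, starPi l0 l1 l2 l12 n.succPNat (k + (n + 1)).succPNat =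
      l0 ^ n * l1 * ((1 - (l2 + l12)) ^ k * (1 - (1 - (l2 + l12)))) := by
    intro k
    have hne : n.succPNat ≠ (k + (n + 1)).succPNat := fun h => by
      have := Nat.succPNat_injective h
      omega
    have hlt : ¬ (k + (n + 1)).succPNat < n.succPNat := fun h => by
      have := Nat.succPNat_lt_succPNat.mp h
      omega
    have hexp : k + (n + 1) + 1 - (n + 1) - 1 = k := by omega
    simp only [starPi, if_neg hne, if_neg hlt, Nat.succPNat_coe, Nat.succ_eq_add_one,
      Nat.add_sub_cancel, hexp]
    ring
  have hdiag : starPi l0 l1 l2 l12 n.succPNat n.succPNat = l0 ^ n * l12 := by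
    simp [starPi]
  have htail : HasSum (fun k : ℕ => starPi l0 l1 l2 l12 n.succPNat (k + (n + 1)).succPNat)
      (l0 ^ n * l1 * 1) := by
    simp only [hterm]
    exact (hasSum_one_sub_mul_geometric (by linarith) (by linarith)).mul_left _
  have h := (hasSum_nat_add_iff
    (f := fun k : ℕ => starPi l0 l1 l2 l12 n.succPNat k.succPNat) (n + 1)).mp htail
  rw [Finset.sum_range_succ, sum_range_starPi_succ hsum, hdiag] at h
  have htotal : l0 ^ n * l1 * 1 +
      (((1 - (l1 + l12)) ^ n - l0 ^ n) * (l1 + l12) + l0 ^ n * l12) =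
      (l1 + l12) * (1 - (l1 + l12)) ^ n := by ring
  rwa [htotal] at h

/-- The first marginal of the stationary joint age distribution in the two-receiver star
network is geometric with parameter `1 - c2 = λ1 + λ12`:
`∑_j π(i,j) = (1 - c2) c2^(i-1) = (λ1+λ12)(1-(λ1+λ12))^(i-1)`. -/
theorem starPi_first_marginal_geometric (l0 l1 l2 l12 : ℝ)
    (h0 : 0 ≤ l0) (h1 : 0 ≤ l1) (h2 : 0 ≤ l2) (h12 : 0 ≤ l12)
    (hsum : l0 + l1 + l2 + l12 = 1) (hpos1 : 0 < l1 + l12) (hpos2 : 0 < l2 + l12) :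
    ∀ i : ℕ+,
      (∑' j : ℕ+, starPi l0 l1 l2 l12 i j) =
          (1 - (1 - (l1 + l12))) * (1 - (l1 + l12)) ^ ((i : ℕ) - 1) ∧
      (1 - (1 - (l1 + l12))) * (1 - (l1 + l12)) ^ ((i : ℕ) - 1) =
          (l1 + l12) * (1 - (l1 + l12)) ^ ((i : ℕ) - 1) := by
  intro i
  refine ⟨?_, by rw [sub_sub_cancel]⟩
  have h := hasSum_starPi_succ h0 h1 hsum hpos2 i.natPred
  rw [PNat.succPNat_natPred] at h
  have h' : HasSum (fun j : ℕ+ => starPi l0 l1 l2 l12 i j)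
      ((l1 + l12) * (1 - (l1 + l12)) ^ i.natPred) :=
    (Equiv.pnatEquivNat.symm.hasSum_iff (f := fun j : ℕ+ => starPi l0 l1 l2 l12 i j)).mp h
  rw [h'.tsum_eq, sub_sub_cancel, PNat.natPred]
end

section
/- Fix nonnegative reals λ∅, λ1, λ2, λ12 with λ∅ + λ1 + λ2 + λ12 = 1, λ1 + λ12 > 0 and λ2 + λ12 > 0 (note these force λ∅ < 1). Let (A1, A2) be a random pair of positive integers with joint probability mass function π given by: π(i,i) = λ∅^{i−1}λ12; π(i,j) = λ∅^{j−1}λ2·c2^{i−j−1}(1−c2) if i > j; π(i,j) = λ∅^{i−1}λ1·c1^{j−i−1}(1−c1) if i < j, where c1 = 1−(λ2+λ12), c2 = 1−(λ1+λ12). Then Cov(A1, A2) = (λ∅·λ12 − λ1·λ2) / ((λ1+λ12)(λ2+λ12)(1−λ∅)). -/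
open MeasureTheory

/-- A set whose outer measure and that of its complement add up to the (finite) total mass is
null measurable. -/
lemma nullMeasurableSet_of_measure_add_measure_compl_le {Ω : Type*} [MeasurableSpace Ω]
    {μ : Measure Ω} [IsFiniteMeasure μ] {s : Set Ω} (h : μ s + μ sᶜ ≤ μ Set.univ) :
    NullMeasurableSet s μ := by
  have hunion : toMeasurable μ s ∪ toMeasurable μ sᶜ = Set.univ :=
    Set.eq_univ_of_univ_subset <| by
      rw [← Set.union_compl_self s]
      exact Set.union_subset_union (subset_toMeasurable μ s) (subset_toMeasurable μ sᶜ)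
  have hadd := measure_union_add_inter (μ := μ) (toMeasurable μ s)
    (measurableSet_toMeasurable μ sᶜ)
  rw [hunion, measure_toMeasurable, measure_toMeasurable] at hadd
  have hinter : μ (toMeasurable μ s ∩ toMeasurable μ sᶜ) = 0 := by
    rw [← hadd] at h
    exact nonpos_iff_eq_zero.1 <|
      (ENNReal.add_le_add_iff_left (measure_ne_top μ Set.univ)).1 (by simpa using h)
  have hdiff : μ (toMeasurable μ s \ s) = 0 :=
    measure_mono_null
      (Set.inter_subset_inter_right _ (subset_toMeasurable μ sᶜ)) hinter
  rw [← Set.sdiff_sdiff_cancel_left (subset_toMeasurable μ s)]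
  exact (measurableSet_toMeasurable μ s).nullMeasurableSet.diff (NullMeasurableSet.of_null hdiff)

/-- A map to a countable type is a.e. measurable as soon as the outer measures of its fibers add up
to the (finite) total mass. -/
lemma aemeasurable_of_tsum_measure_fiber_le {Ω β : Type*} [MeasurableSpace Ω] [Countable β]
    [MeasurableSpace β] [DiscreteMeasurableSpace β] {μ : Measure Ω} [IsFiniteMeasure μ]
    {X : Ω → β} (h : ∑' b, μ (X ⁻¹' {b}) ≤ μ Set.univ) : AEMeasurable X μ := by
  have hle (S : Set β) : μ (X ⁻¹' S) ≤ ∑' b : S, μ (X ⁻¹' {(b : β)}) := by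
    refine (measure_mono ?_).trans (measure_iUnion_le _)
    intro ω hω
    exact Set.mem_iUnion.2 ⟨⟨X ω, hω⟩, rfl⟩
  have hnull : NullMeasurable X μ := fun S _ => by
    refine nullMeasurableSet_of_measure_add_measure_compl_le (le_trans ?_ h)
    rw [← ENNReal.summable.tsum_add_tsum_compl (s := S) ENNReal.summable]
    exact add_le_add (hle S) (hle Sᶜ)
  exact hnull.aemeasurable

/-- The law of the unconscious statistician for a nonnegative function of a random element of a
countable type with probability mass function `p`, measurability not being assumed. -/
lemma integral_comp_eq_of_hasSum {Ω β : Type*} [MeasurableSpace Ω] [Countable β]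
    {μ : Measure Ω} [IsProbabilityMeasure μ] {X : Ω → β} {p f : β → ℝ} {a : ℝ}
    (hX : ∀ b, μ (X ⁻¹' {b}) = ENNReal.ofReal (p b)) (hp : ∀ b, 0 ≤ p b) (hp1 : HasSum p 1)
    (hf : ∀ b, 0 ≤ f b) (ha : HasSum (fun b => f b * p b) a) :
    ∫ ω, f (X ω) ∂μ = a := by
  let _ : MeasurableSpace β := ⊤
  have hXm : AEMeasurable X μ := by
    refine aemeasurable_of_tsum_measure_fiber_le (le_of_eq ?_)
    simp_rw [hX]
    rw [← ENNReal.ofReal_tsum_of_nonneg hp hp1.summable, hp1.tsum_eq]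
    simp
  have hfm : Measurable f := measurable_from_top
  rw [← integral_map hXm hfm.aestronglyMeasurable,
    integral_eq_lintegral_of_nonneg_ae (.of_forall hf) hfm.aestronglyMeasurable,
    lintegral_countable']
  have hterm (b : β) : ENNReal.ofReal (f b) * μ.map X {b} = ENNReal.ofReal (f b * p b) := by
    rw [Measure.map_apply_of_aemeasurable hXm (MeasurableSet.singleton b), hX,
      ENNReal.ofReal_mul (hf b)]
  simp_rw [hterm]
  rw [← ENNReal.ofReal_tsum_of_nonneg (fun b => mul_nonneg (hf b) (hp b)) ha.summable, ha.tsum_eq,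
    ENNReal.toReal_ofReal (ha.nonneg fun b => mul_nonneg (hf b) (hp b))]

lemma hasSum_succ_mul_geometric {x : ℝ} (hx : 0 ≤ x) (hx1 : x < 1) :
    HasSum (fun n : ℕ => ((n : ℝ) + 1) * x ^ n) (1 / (1 - x) ^ 2) := by
  simpa using hasSum_choose_mul_geometric_of_norm_lt_one 1 (r := x) (by
    rwa [Real.norm_of_nonneg hx])

lemma hasSum_succ_sq_mul_geometric {x : ℝ} (hx : 0 ≤ x) (hx1 : x < 1) :
    HasSum (fun n : ℕ => ((n : ℝ) + 1) ^ 2 * x ^ n) ((1 + x) / (1 - x) ^ 3) := by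
  have h := hasSum_choose_mul_geometric_of_norm_lt_one 2 (r := x) (by
    rwa [Real.norm_of_nonneg hx])
  convert! (h.mul_left 2).sub (hasSum_succ_mul_geometric hx hx1) using 1
  · ext n
    rw [Nat.cast_choose_two]
    push_cast
    ring
  · have : 1 - x ≠ 0 := by linarith
    field_simp
    ring

lemma HasSum.mul_of_nonneg {ι κ : Type*} {f : ι → ℝ} {g : κ → ℝ} {a b : ℝ}
    (hf : HasSum f a) (hg : HasSum g b) (hf0 : ∀ i, 0 ≤ f i) (hg0 : ∀ k, 0 ≤ g k) :
    HasSum (fun x : ι × κ => f x.1 * g x.2) (a * b) :=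
  hf.mul hg (hf.summable.mul_of_nonneg hg.summable hf0 hg0)

/-- A sum over pairs of positive integers splits into the diagonal and the two triangles. -/
lemma hasSum_pnat_prod_of_trichotomy {F : ℕ+ × ℕ+ → ℝ} {a b c : ℝ}
    (ha : HasSum (fun n : ℕ => F (n.succPNat, n.succPNat)) a)
    (hb : HasSum (fun x : ℕ × ℕ => F ((x.1 + x.2 + 1).succPNat, x.1.succPNat)) b)
    (hc : HasSum (fun x : ℕ × ℕ => F (x.1.succPNat, (x.1 + x.2 + 1).succPNat)) c) :
    HasSum F (a + b + c) := by
  have h1 : HasSum (fun p : ℕ+ × ℕ+ => if p.1 = p.2 then F p else 0) a := by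
    refine (Function.Injective.hasSum_iff
      (g := fun n : ℕ => ((n.succPNat, n.succPNat) : ℕ+ × ℕ+)) ?_ ?_).1 ?_
    · intro m n h
      simpa using h
    · rintro ⟨i, j⟩ hij
      refine if_neg fun h => hij ⟨i.natPred, ?_⟩
      change i = j at h
      simp [← h]
    · simpa [Function.comp_def] using ha
  have h2 : HasSum (fun p : ℕ+ × ℕ+ => if p.2 < p.1 then F p else 0) b := by
    refine (Function.Injective.hasSum_iff
      (g := fun x : ℕ × ℕ => (((x.1 + x.2 + 1).succPNat, x.1.succPNat) : ℕ+ × ℕ+)) ?_ ?_).1 ?_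
    · rintro ⟨m, k⟩ ⟨m', k'⟩ h
      simp only [Prod.mk.injEq, Nat.succPNat_inj] at h ⊢
      omega
    · rintro ⟨i, j⟩ hij
      refine if_neg fun h => hij ⟨(j.natPred, (i : ℕ) - j - 1), ?_⟩
      change (j : ℕ) < i at h
      have := j.pos
      refine Prod.ext (PNat.eq ?_) (PNat.eq ?_) <;>
        simp only [Nat.succPNat_coe, PNat.natPred] <;> omega
    · convert! hb using 2 with x
      exact if_pos (PNat.coe_lt_coe _ _ |>.1 (by simp))
  have h3 : HasSum (fun p : ℕ+ × ℕ+ => if p.1 < p.2 then F p else 0) c := by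
    refine (Function.Injective.hasSum_iff
      (g := fun x : ℕ × ℕ => ((x.1.succPNat, (x.1 + x.2 + 1).succPNat) : ℕ+ × ℕ+)) ?_ ?_).1 ?_
    · rintro ⟨m, k⟩ ⟨m', k'⟩ h
      simp only [Prod.mk.injEq, Nat.succPNat_inj] at h ⊢
      omega
    · rintro ⟨i, j⟩ hij
      refine if_neg fun h => hij ⟨(i.natPred, (j : ℕ) - i - 1), ?_⟩
      change (i : ℕ) < j at h
      have := i.pos
      refine Prod.ext (PNat.eq ?_) (PNat.eq ?_) <;>
        simp only [Nat.succPNat_coe, PNat.natPred] <;> omega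
    · convert! hc using 2 with x
      exact if_pos (PNat.coe_lt_coe _ _ |>.1 (by simp))
  convert! (h1.add h2).add h3 using 2 with p
  rcases lt_trichotomy p.1 p.2 with h | h | h
  · simp [h, h.ne, h.not_gt]
  · simp [h]
  · simp [h, h.ne', h.not_gt]

lemma starPi_diag (l0 l1 l2 l12 : ℝ) (n : ℕ) : starPi l0 l1 l2 l12 n.succPNat n.succPNat = l0 ^ n * l12 := by
  simp [starPi]

lemma starPi_lower (l0 l1 l2 l12 : ℝ) (n k : ℕ) : starPi l0 l1 l2 l12 (n + k + 1).succPNat n.succPNat =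
    l0 ^ n * l2 * (1 - (l1 + l12)) ^ k * (l1 + l12) := by
  have h : n.succPNat < (n + k + 1).succPNat := PNat.coe_lt_coe _ _ |>.1 (by simp)
  have hk : n + k + 1 + 1 - (n + 1) - 1 = k := by omega
  simp only [starPi, h.ne', h, if_true, if_false, Nat.succPNat_coe, Nat.succ_eq_add_one, hk,
    Nat.add_sub_cancel]

lemma starPi_upper (l0 l1 l2 l12 : ℝ) (n k : ℕ) : starPi l0 l1 l2 l12 n.succPNat (n + k + 1).succPNat =
    l0 ^ n * l1 * (1 - (l2 + l12)) ^ k * (l2 + l12) := by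
  have h : n.succPNat < (n + k + 1).succPNat := PNat.coe_lt_coe _ _ |>.1 (by simp)
  have hk : n + k + 1 + 1 - (n + 1) - 1 = k := by omega
  simp only [starPi, h.ne, h.not_gt, if_false, Nat.succPNat_coe, Nat.succ_eq_add_one, hk,
    Nat.add_sub_cancel]

lemma starPi_nonneg {l0 l1 l2 l12 : ℝ} (h0 : 0 ≤ l0) (h1 : 0 ≤ l1) (h2 : 0 ≤ l2)
    (h12 : 0 ≤ l12) (hsum : l0 + l1 + l2 + l12 = 1) (i j : ℕ+) :
    0 ≤ starPi l0 l1 l2 l12 i j := by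
  have hc1 : 0 ≤ 1 - (l1 + l12) := by linarith
  have hc2 : 0 ≤ 1 - (l2 + l12) := by linarith
  unfold starPi
  split_ifs <;> positivity

lemma hasSum_mul_starPi {l0 l1 l2 l12 a b c : ℝ} (f : ℕ → ℕ → ℝ)
    (ha : HasSum (fun n : ℕ => f (n + 1) (n + 1) * l0 ^ n) a)
    (hb : HasSum (fun x : ℕ × ℕ => f (x.1 + x.2 + 2) (x.1 + 1) *
      (l0 ^ x.1 * (1 - (l1 + l12)) ^ x.2)) b)
    (hc : HasSum (fun x : ℕ × ℕ => f (x.1 + 1) (x.1 + x.2 + 2) *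
      (l0 ^ x.1 * (1 - (l2 + l12)) ^ x.2)) c) :
    HasSum (fun p : ℕ+ × ℕ+ => f p.1 p.2 * starPi l0 l1 l2 l12 p.1 p.2)
      (a * l12 + b * (l2 * (l1 + l12)) + c * (l1 * (l2 + l12))) := by
  apply hasSum_pnat_prod_of_trichotomy
  · convert! ha.mul_right l12 using 2 with n
    rw [starPi_diag, Nat.succPNat_coe]
    ring
  · convert! hb.mul_right (l2 * (l1 + l12)) using 2 with x
    rw [starPi_lower, Nat.succPNat_coe, Nat.succPNat_coe]
    ring
  · convert! hc.mul_right (l1 * (l2 + l12)) using 2 with x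
    rw [starPi_upper, Nat.succPNat_coe, Nat.succPNat_coe]
    ring

/-- The weighted sums over an open triangle, parametrised by `(min, difference)`, of
`1`, the smaller coordinate, the larger coordinate, and their product. -/
lemma hasSum_triangle_moments {x y : ℝ} (hx : 0 ≤ x) (hx1 : x < 1) (hy : 0 ≤ y) (hy1 : y < 1) :
    HasSum (fun p : ℕ × ℕ => x ^ p.1 * y ^ p.2) (1 / ((1 - x) * (1 - y))) ∧
    HasSum (fun p : ℕ × ℕ => ((p.1 : ℝ) + 1) * (x ^ p.1 * y ^ p.2))
      (1 / ((1 - x) ^ 2 * (1 - y))) ∧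
    HasSum (fun p : ℕ × ℕ => ((p.1 : ℝ) + p.2 + 2) * (x ^ p.1 * y ^ p.2))
      (1 / ((1 - x) ^ 2 * (1 - y)) + 1 / ((1 - x) * (1 - y) ^ 2)) ∧
    HasSum (fun p : ℕ × ℕ => ((p.1 : ℝ) + p.2 + 2) * ((p.1 : ℝ) + 1) * (x ^ p.1 * y ^ p.2))
      ((1 + x) / ((1 - x) ^ 3 * (1 - y)) + 1 / ((1 - x) ^ 2 * (1 - y) ^ 2)) := by
  have gx := hasSum_geometric_of_lt_one hx hx1
  have gy := hasSum_geometric_of_lt_one hy hy1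
  have g1x := hasSum_succ_mul_geometric hx hx1
  have g1y := hasSum_succ_mul_geometric hy hy1
  have g2x := hasSum_succ_sq_mul_geometric hx hx1
  have n0 {z : ℝ} (hz : 0 ≤ z) (n : ℕ) : 0 ≤ z ^ n := by positivity
  have n1 {z : ℝ} (hz : 0 ≤ z) (n : ℕ) : 0 ≤ ((n : ℝ) + 1) * z ^ n := by positivity
  have n2 (n : ℕ) : 0 ≤ ((n : ℝ) + 1) ^ 2 * x ^ n := by positivity
  have h00 := gx.mul_of_nonneg gy (n0 hx) (n0 hy)
  have h10 := g1x.mul_of_nonneg gy (n1 hx) (n0 hy)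
  have h01 := gx.mul_of_nonneg g1y (n0 hx) (n1 hy)
  have h11 := g1x.mul_of_nonneg g1y (n1 hx) (n1 hy)
  have h20 := g2x.mul_of_nonneg gy n2 (n0 hy)
  refine ⟨?_, ?_, ?_, ?_⟩
  · convert! h00 using 1
    field_simp
  · convert! h10 using 1
    · ext p
      ring
    · field_simp
  · convert! h10.add h01 using 1
    · ext p
      ring
    · field_simp
  · convert! h20.add h11 using 1
    · ext p
      ring
    · field_simp

/-- The total mass, the two means and the mixed second moment of `starPi`. -/
lemma hasSum_starPi_moments {l0 l1 l2 l12 : ℝ} (h0 : 0 ≤ l0) (h1 : 0 ≤ l1) (h2 : 0 ≤ l2)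
    (hsum : l0 + l1 + l2 + l12 = 1) (hpos1 : 0 < l1 + l12)
    (hpos2 : 0 < l2 + l12) :
    HasSum (fun p : ℕ+ × ℕ+ => starPi l0 l1 l2 l12 p.1 p.2) 1 ∧
    HasSum (fun p : ℕ+ × ℕ+ => ((p.1 : ℕ) : ℝ) * starPi l0 l1 l2 l12 p.1 p.2)
      (1 / (l1 + l12)) ∧
    HasSum (fun p : ℕ+ × ℕ+ => ((p.2 : ℕ) : ℝ) * starPi l0 l1 l2 l12 p.1 p.2)
      (1 / (l2 + l12)) ∧
    HasSum (fun p : ℕ+ × ℕ+ => (((p.1 : ℕ) : ℝ) * ((p.2 : ℕ) : ℝ)) * starPi l0 l1 l2 l12 p.1 p.2)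
      (1 / ((l1 + l12) * (l2 + l12)) +
        (l0 * l12 - l1 * l2) / ((l1 + l12) * (l2 + l12) * (1 - l0))) := by
  have hl0 : l0 < 1 := by linarith
  obtain ⟨b0, bm, bM, bmM⟩ := hasSum_triangle_moments (y := 1 - (l1 + l12)) h0 hl0
    (by linarith) (by linarith)
  obtain ⟨c0, cm, cM, cmM⟩ := hasSum_triangle_moments (y := 1 - (l2 + l12)) h0 hl0
    (by linarith) (by linarith)
  have d0 := hasSum_geometric_of_lt_one h0 hl0
  have d1 := hasSum_succ_mul_geometric h0 hl0
  have d2 := hasSum_succ_sq_mul_geometric h0 hl0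
  have m0 := hasSum_mul_starPi (fun _ _ => 1) (by simpa only [one_mul] using d0)
    (by simpa only [one_mul] using b0) (by simpa only [one_mul] using c0)
  have m1 := hasSum_mul_starPi (fun i _ => i) (by simpa using d1) (by simpa using bM)
    (by simpa using cm)
  have m2 := hasSum_mul_starPi (fun _ j => j) (by simpa using d1) (by simpa using bm)
    (by simpa using cM)
  have m12 := hasSum_mul_starPi (fun i j => (i : ℝ) * j) (by simpa [sq] using d2)
    (by simpa using bmM) (by simpa [mul_comm ((_ : ℝ) + 1)] using cmM)
  simp only [one_mul] at m0
  have hs : l1 + l2 + l12 ≠ 0 := by linarith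
  obtain rfl : l0 = 1 - (l1 + l2 + l12) := by linarith
  simp only [sub_sub_cancel] at m0 m1 m2 m12 ⊢
  refine ⟨?_, ?_, ?_, ?_⟩
  · convert! m0 using 1
    field_simp
    ring
  · convert! m1 using 1
    field_simp
    ring
  · convert! m2 using 1
    field_simp
    ring
  · convert! m12 using 1
    field_simp
    ring

/-- Covariance of the two stationary ages in the two-receiver star network:
`Cov(A1,A2) = E[A1 A2] - E[A1] E[A2]
            = (λ∅ λ12 - λ1 λ2) / ((λ1+λ12)(λ2+λ12)(1-λ∅))`. -/
theorem starPi_covariance {Ω : Type*} [MeasurableSpace Ω]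
    (μ : Measure Ω) [IsProbabilityMeasure μ]
    (l0 l1 l2 l12 : ℝ)
    (h0 : 0 ≤ l0) (h1 : 0 ≤ l1) (h2 : 0 ≤ l2) (h12 : 0 ≤ l12)
    (hsum : l0 + l1 + l2 + l12 = 1) (hpos1 : 0 < l1 + l12) (hpos2 : 0 < l2 + l12)
    (A1 A2 : Ω → ℕ+)
    (hjoint : ∀ i j : ℕ+,
      μ {ω | A1 ω = i ∧ A2 ω = j} = ENNReal.ofReal (starPi l0 l1 l2 l12 i j)) :
    (∫ ω, ((A1 ω : ℕ) : ℝ) * ((A2 ω : ℕ) : ℝ) ∂μ) -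
        (∫ ω, ((A1 ω : ℕ) : ℝ) ∂μ) * (∫ ω, ((A2 ω : ℕ) : ℝ) ∂μ) =
      (l0 * l12 - l1 * l2) / ((l1 + l12) * (l2 + l12) * (1 - l0)) := by
  have hX (b : ℕ+ × ℕ+) : μ ((fun ω => (A1 ω, A2 ω)) ⁻¹' {b}) =
      ENNReal.ofReal (starPi l0 l1 l2 l12 b.1 b.2) := by
    rw [← hjoint]
    congr 1
    ext ω
    simp [Prod.ext_iff]
  have hp (b : ℕ+ × ℕ+) := starPi_nonneg h0 h1 h2 h12 hsum b.1 b.2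
  obtain ⟨hm, hm1, hm2, hm12⟩ := hasSum_starPi_moments h0 h1 h2 hsum hpos1 hpos2
  have e1 := integral_comp_eq_of_hasSum hX hp hm (fun _ => by positivity) hm1
  have e2 := integral_comp_eq_of_hasSum hX hp hm (fun _ => by positivity) hm2
  have e12 := integral_comp_eq_of_hasSum hX hp hm (fun _ => by positivity) hm12
  rw [e1, e2, e12, one_div_mul_one_div, add_sub_cancel_left]
end

section
/- Fix nonnegative reals λ∅, λ1, λ2, λ12 with λ∅ + λ1 + λ2 + λ12 = 1, λ1 + λ12 > 0 and λ2 + λ12 > 0, and suppose the no-interaction condition (λ1+λ12)(λ2+λ12) = λ12 holds. Let π be given by: π(i,i) = λ∅^{i−1}λ12; π(i,j) = λ∅^{j−1}λ2·c2^{i−j−1}(1−c2) if i > j; π(i,j) = λ∅^{i−1}λ1·c1^{j−i−1}(1−c1) if i < j, where c1 = 1−(λ2+λ12), c2 = 1−(λ1+λ12). Then π has product form: for all positive integers i, j, π(i,j) = [(1−c2)c2^{i−1}]·[(1−c1)c1^{j−1}], i.e. π is the product of its two geometric marginals; in particular the covariance of the two coordinates under π is 0. -/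
theorem tsum_pnat_geometric_eq_one {p : ℝ} (hp : 0 < p) (hp' : p ≤ 1) :
    ∑' i : ℕ+, p * (1 - p) ^ ((i : ℕ) - 1) = 1 := by
  have h := tsum_pnat_eq_tsum_succ (f := fun n : ℕ => p * (1 - p) ^ (n - 1))
  simp only [Nat.add_sub_cancel] at h
  rw [h, tsum_mul_left, tsum_geometric_of_lt_one (by linarith) (by linarith), sub_sub_cancel,
    mul_inv_cancel₀ hp.ne']

theorem covariance_mul_eq_zero {f g : ℕ+ → ℝ} (hf : ∑' i, f i = 1) (hg : ∑' j, g j = 1) :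
    (∑' (i : ℕ+) (j : ℕ+), ((i : ℕ) : ℝ) * ((j : ℕ) : ℝ) * (f i * g j)) -
        (∑' (i : ℕ+) (j : ℕ+), ((i : ℕ) : ℝ) * (f i * g j)) *
          (∑' (i : ℕ+) (j : ℕ+), ((j : ℕ) : ℝ) * (f i * g j)) = 0 := by
  have hprod (u v : ℕ+ → ℝ) : ∑' (i : ℕ+) (j : ℕ+), u i * v j = (∑' i, u i) * ∑' j, v j := by
    simp only [tsum_mul_left, tsum_mul_right]
  have hl (i j : ℕ+) : ((i : ℕ) : ℝ) * (f i * g j) = (i : ℕ) * f i * g j := by ring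
  have hr (i j : ℕ+) : ((j : ℕ) : ℝ) * (f i * g j) = f i * ((j : ℕ) * g j) := by ring
  simp only [mul_mul_mul_comm, hl, hr]
  rw [hprod (fun i => (i : ℕ) * f i) (fun j => (j : ℕ) * g j), hprod (fun i => (i : ℕ) * f i) g,
    hprod f (fun j => (j : ℕ) * g j), hf, hg, mul_one, one_mul, sub_self]

theorem starPi_eq_mul {l0 l1 l2 l12 : ℝ} (hsum : l0 + l1 + l2 + l12 = 1)
    (hnointer : (l1 + l12) * (l2 + l12) = l12) (i j : ℕ+) :
    starPi l0 l1 l2 l12 i j =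
      ((l1 + l12) * (1 - (l1 + l12)) ^ ((i : ℕ) - 1)) *
        ((l2 + l12) * (1 - (l2 + l12)) ^ ((j : ℕ) - 1)) := by
  have e0 : l0 = (1 - (l1 + l12)) * (1 - (l2 + l12)) := by linarith
  have e1 : l1 = (l1 + l12) * (1 - (l2 + l12)) := by linarith
  have e2 : l2 = (l2 + l12) * (1 - (l1 + l12)) := by linarith
  unfold starPi
  generalize l1 + l12 = p at *
  generalize l2 + l12 = q at *
  subst e0 e1 e2 hnointer
  have hi := i.pos
  have hj := j.pos
  split_ifs with hij hji
  · subst hij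
    rw [mul_pow]
    ring
  · rw [← PNat.coe_lt_coe] at hji
    have h : (i : ℕ) - 1 = (j - 1) + 1 + (i - j - 1) := by omega
    rw [h, mul_pow, pow_add, pow_succ]
    ring
  · have hlt : (i : ℕ) < j := lt_of_le_of_ne (not_lt.mp hji) (fun h => hij (PNat.eq h))
    have h : (j : ℕ) - 1 = (i - 1) + 1 + (j - i - 1) := by omega
    rw [h, mul_pow, pow_add, pow_succ]
    ring

/-- Under the no-interaction condition `(λ1+λ12)(λ2+λ12) = λ12`, the stationary joint age
distribution of the two-receiver star network has product form — it is the product of its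
two geometric marginals — and in particular the covariance of the two coordinates is `0`. -/
theorem starPi_product_form_of_no_interaction (l0 l1 l2 l12 : ℝ)
    (h0 : 0 ≤ l0) (h1 : 0 ≤ l1) (h2 : 0 ≤ l2) (h12 : 0 ≤ l12)
    (hsum : l0 + l1 + l2 + l12 = 1) (hpos1 : 0 < l1 + l12) (hpos2 : 0 < l2 + l12)
    (hnointer : (l1 + l12) * (l2 + l12) = l12) :
    (∀ i j : ℕ+,
      starPi l0 l1 l2 l12 i j =
        ((l1 + l12) * (1 - (l1 + l12)) ^ ((i : ℕ) - 1)) *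
          ((l2 + l12) * (1 - (l2 + l12)) ^ ((j : ℕ) - 1))) ∧
    (∑' (i : ℕ+) (j : ℕ+), ((i : ℕ) : ℝ) * ((j : ℕ) : ℝ) * starPi l0 l1 l2 l12 i j) -
        (∑' (i : ℕ+) (j : ℕ+), ((i : ℕ) : ℝ) * starPi l0 l1 l2 l12 i j) *
          (∑' (i : ℕ+) (j : ℕ+), ((j : ℕ) : ℝ) * starPi l0 l1 l2 l12 i j) = 0 := by
  refine ⟨starPi_eq_mul hsum hnointer, ?_⟩
  simp only [starPi_eq_mul hsum hnointer]
  exact covariance_mul_eq_zero (tsum_pnat_geometric_eq_one hpos1 (by linarith))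
    (tsum_pnat_geometric_eq_one hpos2 (by linarith))
end

section
/- Fix nonnegative reals λ∅, λ1, λ2, λ12 with λ∅ + λ1 + λ2 + λ12 = 1, and suppose all four are strictly positive. Let P be the Markov transition kernel on pairs of positive integers which from state (i,j) moves to (i+1, j+1) with probability λ∅, to (1, j+1) with probability λ1, to (i+1, 1) with probability λ2, and to (1, 1) with probability λ12. Then P has a unique stationary probability distribution, namely π given by: π(i,i) = λ∅^{i−1}λ12; π(i,j) = λ∅^{j−1}λ2·c2^{i−j−1}(1−c2) if i > j; π(i,j) = λ∅^{i−1}λ1·c1^{j−i−1}(1−c1) if i < j, where c1 = 1−(λ2+λ12), c2 = 1−(λ1+λ12). That is, any probability distribution ν on pairs of positive integers satisfying ν(k,l) = Σ_{(i,j)} ν(i,j)·P((i,j),(k,l)) for all (k,l) equals π. -/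
/-- The transition kernel of the joint ages `(A1, A2)` in the two-receiver star network:
from `(i,j)` move to `(i+1, j+1)` w.p. `λ∅`, to `(1, j+1)` w.p. `λ1`, to `(i+1, 1)` w.p. `λ2`,
and to `(1,1)` w.p. `λ12`. -/
def starKernel (l0 l1 l2 l12 : ℝ) (s t : ℕ+ × ℕ+) : ℝ :=
  (if t = (s.1 + 1, s.2 + 1) then l0 else 0) +
  (if t = (1, s.2 + 1) then l1 else 0) +
  (if t = (s.1 + 1, 1) then l2 else 0) +
  (if t = (1, 1) then l12 else 0)

theorem PNat.tsum_eq_one_add {f : ℕ+ → ℝ} (hf : Summable f) :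
    ∑' n, f n = f 1 + ∑' n, f (n + 1) := by
  have hf' : Summable fun n : ℕ => f n.succPNat := Equiv.pnatEquivNat.symm.summable_iff.2 hf
  calc ∑' n, f n = ∑' n : ℕ, f n.succPNat := (Equiv.pnatEquivNat.symm.tsum_eq f).symm
    _ = f 1 + ∑' n : ℕ, f (n.succPNat + 1) := hf'.tsum_eq_zero_add
    _ = f 1 + ∑' n, f (n + 1) := by
      rw [← Equiv.pnatEquivNat.symm.tsum_eq fun n => f (n + 1)]
      rfl

theorem PNat.one_ne_add_one (n : ℕ+) : (1 : ℕ+) ≠ n + 1 :=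
  (PNat.lt_add_left 1 n).ne

theorem starKernel_swap (l0 l1 l2 l12 : ℝ) (s t : ℕ+ × ℕ+) :
    starKernel l0 l1 l2 l12 s.swap t.swap = starKernel l0 l2 l1 l12 s t := by
  obtain ⟨i, j⟩ := s
  obtain ⟨k, l⟩ := t
  simp only [starKernel, Prod.swap_prod_mk, Prod.mk.injEq, and_comm]
  ring

theorem starKernel_one_one (l0 l1 l2 l12 : ℝ) (s : ℕ+ × ℕ+) :
    starKernel l0 l1 l2 l12 s (1, 1) = l12 := by
  simp [starKernel, PNat.one_ne_add_one]

theorem starKernel_one_succ (l0 l1 l2 l12 : ℝ) (s : ℕ+ × ℕ+) (l : ℕ+) :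
    starKernel l0 l1 l2 l12 s (1, l + 1) = if s.2 = l then l1 else 0 := by
  simp [starKernel, PNat.one_ne_add_one, (PNat.one_ne_add_one _).symm, eq_comm]

theorem starKernel_succ_succ (l0 l1 l2 l12 : ℝ) (s : ℕ+ × ℕ+) (k l : ℕ+) :
    starKernel l0 l1 l2 l12 s (k + 1, l + 1) = if s = (k, l) then l0 else 0 := by
  obtain ⟨i, j⟩ := s
  simp [starKernel, (PNat.one_ne_add_one _).symm, eq_comm (a := k), eq_comm (a := l)]

theorem starPi_succ_succ (l0 l1 l2 l12 : ℝ) (i j : ℕ+) :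
    starPi l0 l1 l2 l12 (i + 1) (j + 1) = l0 * starPi l0 l1 l2 l12 i j := by
  have hpow (n : ℕ+) : l0 ^ (((n + 1 : ℕ+) : ℕ) - 1) = l0 * l0 ^ ((n : ℕ) - 1) := by
    rw [← pow_succ', PNat.add_coe, PNat.one_coe, Nat.add_sub_cancel, Nat.sub_add_cancel n.pos]
  have hsub (m n : ℕ+) : ((m + 1 : ℕ+) : ℕ) - ((n + 1 : ℕ+) : ℕ) = (m : ℕ) - n := by
    simp
  simp only [starPi, add_left_inj, add_lt_add_iff_right, hpow, hsub]
  split_ifs <;> ring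

section Stationary

variable {l0 l1 l2 l12 : ℝ} {ν : ℕ+ × ℕ+ → ℝ}

theorem stationary_one_one (hsum : ∑' s, ν s = 1)
    (hstat : ∀ t, ν t = ∑' s, ν s * starKernel l0 l1 l2 l12 s t) : ν (1, 1) = l12 := by
  rw [hstat]
  simp only [starKernel_one_one]
  rw [tsum_mul_right, hsum, one_mul]

theorem stationary_succ_succ
    (hstat : ∀ t, ν t = ∑' s, ν s * starKernel l0 l1 l2 l12 s t) (k l : ℕ+) :
    ν (k + 1, l + 1) = l0 * ν (k, l) := by
  rw [hstat, tsum_eq_single (k, l)]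
  · simp [starKernel_succ_succ, mul_comm]
  · intro s hs
    simp [starKernel_succ_succ, hs]

theorem stationary_one_succ (hν : Summable ν)
    (hstat : ∀ t, ν t = ∑' s, ν s * starKernel l0 l1 l2 l12 s t) (l : ℕ+) :
    ν (1, l + 1) = l1 * ∑' i, ν (i, l) := by
  have hs : Summable fun s : ℕ+ × ℕ+ => ν s * if s.2 = l then l1 else 0 := by
    refine ((hν.mul_right l1).indicator {s | s.2 = l}).congr fun s => ?_
    simp [Set.indicator_apply]
  rw [hstat]
  simp only [starKernel_one_succ]
  rw [hs.tsum_prod, ← tsum_mul_left]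
  simp [mul_comm]

theorem stationary_swap (hstat : ∀ t, ν t = ∑' s, ν s * starKernel l0 l1 l2 l12 s t)
    (t : ℕ+ × ℕ+) :
    ν t.swap = ∑' s : ℕ+ × ℕ+, ν s.swap * starKernel l0 l2 l1 l12 s t := by
  rw [hstat, ← (Equiv.prodComm ℕ+ ℕ+).tsum_eq]
  simp [starKernel_swap]

theorem stationary_succ_one (hν : Summable ν)
    (hstat : ∀ t, ν t = ∑' s, ν s * starKernel l0 l1 l2 l12 s t) (k : ℕ+) :
    ν (k + 1, 1) = l2 * ∑' j, ν (k, j) :=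
  stationary_one_succ (ν := fun s => ν s.swap) hν.prod_symm (stationary_swap hstat) k

/-- The first coordinate of a stationary distribution is geometric with success probability
`l1 + l12`. -/
theorem stationary_fst_marginal (hν : Summable ν) (hsum : ∑' s, ν s = 1)
    (hstat : ∀ t, ν t = ∑' s, ν s * starKernel l0 l1 l2 l12 s t) (k : ℕ+) :
    ∑' j, ν (k, j) = (l0 + l2) ^ ((k : ℕ) - 1) * (l1 + l12) := by
  induction k using PNat.recOn with
  | one =>
    have htotal : ∑' (j) (i), ν (i, j) = 1 := by
      rw [← hsum, ← (Equiv.prodComm ℕ+ ℕ+).tsum_eq ν]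
      exact hν.prod_symm.tsum_prod.symm
    rw [PNat.tsum_eq_one_add (hν.prod_factor 1), stationary_one_one hsum hstat]
    simp only [stationary_one_succ hν hstat, tsum_mul_left, htotal]
    simp [add_comm]
  | succ k ih =>
    rw [PNat.tsum_eq_one_add (hν.prod_factor (k + 1)), stationary_succ_one hν hstat]
    simp only [stationary_succ_succ hstat, tsum_mul_left, ih]
    obtain ⟨n, rfl⟩ : ∃ n : ℕ, n.succPNat = k := ⟨k.natPred, k.succPNat_natPred⟩
    simp only [PNat.add_coe, Nat.succPNat_coe, PNat.one_coe, Nat.succ_eq_add_one,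
      Nat.add_sub_cancel]
    ring

/-- The second coordinate of a stationary distribution is geometric with success probability
`l2 + l12`. -/
theorem stationary_snd_marginal (hν : Summable ν) (hsum : ∑' s, ν s = 1)
    (hstat : ∀ t, ν t = ∑' s, ν s * starKernel l0 l1 l2 l12 s t) (l : ℕ+) :
    ∑' i, ν (i, l) = (l0 + l1) ^ ((l : ℕ) - 1) * (l2 + l12) :=
  stationary_fst_marginal (ν := fun s => ν s.swap) hν.prod_symm
    (((Equiv.prodComm ℕ+ ℕ+).tsum_eq ν).trans hsum) (stationary_swap hstat) l

end Stationary

/-- When all four reception probabilities are strictly positive, `starPi` is the unique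
stationary probability distribution of the star-network kernel: any probability distribution
`ν` satisfying the balance equations equals it. -/
theorem starPi_unique_stationary (l0 l1 l2 l12 : ℝ)
    (h0 : 0 < l0) (h1 : 0 < l1) (h2 : 0 < l2) (h12 : 0 < l12)
    (hsum : l0 + l1 + l2 + l12 = 1)
    (ν : ℕ+ × ℕ+ → ℝ) (hνnonneg : ∀ s, 0 ≤ ν s) (hνsum : ∑' s : ℕ+ × ℕ+, ν s = 1)
    (hνstat : ∀ t : ℕ+ × ℕ+, ν t = ∑' s : ℕ+ × ℕ+, ν s * starKernel l0 l1 l2 l12 s t) :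
    ν = fun s : ℕ+ × ℕ+ => starPi l0 l1 l2 l12 s.1 s.2 := by
  have hν : Summable ν := by
    by_contra h
    simp [tsum_eq_zero_of_not_summable h] at hνsum
  have hc1 : 1 - (l2 + l12) = l0 + l1 := by linarith
  have hc2 : 1 - (l1 + l12) = l0 + l2 := by linarith
  suffices h : ∀ i j, ν (i, j) = starPi l0 l1 l2 l12 i j from funext fun s => h s.1 s.2
  intro i
  induction i using PNat.recOn with
  | one =>
    intro j
    cases j using PNat.recOn with
    | one => simp [starPi, stationary_one_one hνsum hνstat]
    | succ j =>
      rw [stationary_one_succ hν hνstat, stationary_snd_marginal hν hνsum hνstat]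
      simp [starPi, PNat.one_ne_add_one, hc1, mul_assoc]
  | succ i ih =>
    intro j
    cases j using PNat.recOn with
    | one =>
      rw [stationary_succ_one hν hνstat, stationary_fst_marginal hν hνsum hνstat]
      simp [starPi, (PNat.one_ne_add_one _).symm, hc2, mul_assoc]
    | succ j => rw [stationary_succ_succ hνstat, ih, starPi_succ_succ]
end

section
/- Let X and Y be independent real random variables with X distributed N(μ1, σ1²) and Y distributed N(μ2, σ2²), where σ1, σ2 > 0. Set μ̄ = μ1 − μ2 and Δ = √(σ1² + σ2²). Then E[min(X,Y)²] = (μ1² + σ1²)·Φ(−μ̄/Δ) + (μ2² + σ2²)·Φ(μ̄/Δ) − (μ1 + μ2)·Δ·φ(μ̄/Δ). -/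
open MeasureTheory ProbabilityTheory

/-- The standard normal density `φ(x) = e^{-x²/2} / √(2π)`. -/
noncomputable def stdNormalPDF (x : ℝ) : ℝ := Real.exp (-x ^ 2 / 2) / Real.sqrt (2 * Real.pi)

/-- The standard normal cumulative distribution function `Φ(x) = ∫_{-∞}^x φ(t) dt`. -/
noncomputable def stdNormalCDF (x : ℝ) : ℝ := ∫ t in Set.Iic x, stdNormalPDF t

lemma stdNormalPDF_eq_gaussianPDFReal : stdNormalPDF = gaussianPDFReal 0 1 := by
  ext x
  simp [stdNormalPDF, gaussianPDFReal, div_eq_inv_mul]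

lemma stdNormalPDF_neg (x : ℝ) : stdNormalPDF (-x) = stdNormalPDF x := by
  simp [stdNormalPDF]

lemma hasDerivAt_stdNormalPDF (x : ℝ) : HasDerivAt stdNormalPDF (-(stdNormalPDF x * x)) x := by
  have h : HasDerivAt (fun y : ℝ ↦ -y ^ 2 / 2) (-x) x := by
    refine (((hasDerivAt_id x).pow 2).neg.div_const 2).congr_deriv ?_
    simp only [id_eq]
    ring
  refine (h.exp.div_const (Real.sqrt (2 * Real.pi))).congr_deriv ?_
  simp only [stdNormalPDF]
  ring

lemma integrable_stdNormalPDF : Integrable stdNormalPDF := by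
  rw [stdNormalPDF_eq_gaussianPDFReal]
  exact integrable_gaussianPDFReal 0 1

lemma integrable_stdNormalPDF_mul_pow (n : ℕ) :
    Integrable (fun x ↦ stdNormalPDF x * x ^ n) := by
  have h := (integrable_rpow_mul_exp_neg_mul_sq (b := 1 / 2) (s := n) (by norm_num)
    (by have := n.cast_nonneg (α := ℝ); linarith)).div_const (Real.sqrt (2 * Real.pi))
  refine h.congr (ae_of_all _ fun x ↦ ?_)
  simp only [stdNormalPDF, Real.rpow_natCast]
  rw [show -(1 / 2) * x ^ 2 = -x ^ 2 / 2 by ring]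
  ring

lemma stdNormalCDF_neg_add (x : ℝ) : stdNormalCDF (-x) + stdNormalCDF x = 1 := by
  have h : stdNormalCDF (-x) = ∫ t in Set.Ioi x, stdNormalPDF t := by
    rw [stdNormalCDF, ← integral_comp_neg_Ioi]
    simp [stdNormalPDF_neg]
  rw [h, stdNormalCDF, add_comm,
    intervalIntegral.integral_Iic_add_Ioi integrable_stdNormalPDF.integrableOn
      integrable_stdNormalPDF.integrableOn, stdNormalPDF_eq_gaussianPDFReal]
  exact integral_gaussianPDFReal_eq_one 0 one_ne_zero

lemma tendsto_stdNormalPDF_mul_pow_atBot (n : ℕ) :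
    Filter.Tendsto (fun x ↦ stdNormalPDF x * x ^ n) Filter.atBot (nhds 0) := by
  rw [tendsto_zero_iff_abs_tendsto_zero, Function.comp_def]
  have h := ((tendsto_rpow_abs_mul_exp_neg_mul_sq_cocompact (a := 1 / 2) (by norm_num) n).mono_left
    atBot_le_cocompact).div_const (Real.sqrt (2 * Real.pi))
  rw [zero_div] at h
  refine h.congr fun x ↦ ?_
  simp only [stdNormalPDF, Real.rpow_natCast, abs_mul, abs_div, abs_pow,
    Real.abs_exp, abs_of_nonneg (Real.sqrt_nonneg _)]
  rw [show -(1 / 2) * x ^ 2 = -x ^ 2 / 2 by ring]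
  ring

lemma setIntegral_Iic_stdNormalPDF_mul_id (a : ℝ) :
    ∫ x in Set.Iic a, stdNormalPDF x * x = -stdNormalPDF a := by
  have hint : Integrable (fun x ↦ stdNormalPDF x * x) := by
    simpa using integrable_stdNormalPDF_mul_pow 1
  have hlim : Filter.Tendsto (fun x ↦ -stdNormalPDF x) Filter.atBot (nhds 0) := by
    simpa using (tendsto_stdNormalPDF_mul_pow_atBot 0).neg
  rw [integral_Iic_of_hasDerivAt_of_tendsto' (f := fun x ↦ -stdNormalPDF x)
    (fun x _ ↦ by simpa using (hasDerivAt_stdNormalPDF x).fun_neg) hint.integrableOn hlim, sub_zero]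

lemma setIntegral_Iic_stdNormalPDF_mul_sq (a : ℝ) :
    ∫ x in Set.Iic a, stdNormalPDF x * x ^ 2 = stdNormalCDF a - a * stdNormalPDF a := by
  have hint := integrable_stdNormalPDF_mul_pow 2
  have hlim : Filter.Tendsto (fun x ↦ -(stdNormalPDF x * x)) Filter.atBot (nhds 0) := by
    simpa using (tendsto_stdNormalPDF_mul_pow_atBot 1).neg
  have hderiv (x : ℝ) : HasDerivAt (fun y ↦ -(stdNormalPDF y * y))
      (stdNormalPDF x * x ^ 2 - stdNormalPDF x) x := by
    refine ((hasDerivAt_stdNormalPDF x).fun_mul (hasDerivAt_id' x)).fun_neg.congr_deriv ?_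
    ring
  have h := integral_Iic_of_hasDerivAt_of_tendsto' (a := a) (fun x _ ↦ hderiv x)
    (hint.sub integrable_stdNormalPDF).integrableOn hlim
  rw [integral_sub hint.integrableOn integrable_stdNormalPDF.integrableOn] at h
  rw [stdNormalCDF]
  linarith

lemma setIntegral_Iic_gaussianReal (m : ℝ) {s : ℝ} (hs : 0 < s) (f : ℝ → ℝ) (hf : Measurable f) :
    ∫ x in Set.Iic 0, f x ∂gaussianReal m (.mk (s ^ 2) (sq_nonneg s)) =
      ∫ z in Set.Iic (-m / s), stdNormalPDF z * f (m + s * z) := by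
  have hmap : gaussianReal m (.mk (s ^ 2) (sq_nonneg s)) =
      (gaussianReal 0 1).map (fun z ↦ m + s * z) := by
    rw [← Function.comp_def (fun y ↦ m + y) (fun z ↦ s * z),
      ← Measure.map_map (by fun_prop) (by fun_prop), gaussianReal_map_const_mul,
      gaussianReal_map_const_add]
    simp
  have hpre : (fun z ↦ m + s * z) ⁻¹' Set.Iic 0 = Set.Iic (-m / s) := by
    ext z
    simp only [Set.mem_preimage, Set.mem_Iic, le_div_iff₀ hs]
    constructor <;> intro h <;> linarith
  rw [hmap, setIntegral_map measurableSet_Iic hf.aestronglyMeasurable (by fun_prop), hpre,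
    ← integral_indicator measurableSet_Iic, ← integral_indicator measurableSet_Iic,
    integral_gaussianReal_eq_integral_smul one_ne_zero, stdNormalPDF_eq_gaussianPDFReal]
  congr 1 with z
  by_cases hz : z ∈ Set.Iic (-m / s) <;> simp [hz]

lemma setIntegral_Iic_id_gaussianReal (m : ℝ) {s : ℝ} (hs : 0 < s) :
    ∫ x in Set.Iic 0, x ∂gaussianReal m (.mk (s ^ 2) (sq_nonneg s)) =
      m * stdNormalCDF (-m / s) - s * stdNormalPDF (m / s) := by
  have h0 := integrable_stdNormalPDF
  have h1 : Integrable (fun x ↦ stdNormalPDF x * x) := by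
    simpa using integrable_stdNormalPDF_mul_pow 1
  rw [setIntegral_Iic_gaussianReal m hs _ measurable_id']
  have hexp (z : ℝ) : stdNormalPDF z * (m + s * z) =
      m * stdNormalPDF z + s * (stdNormalPDF z * z) := by ring
  simp_rw [hexp]
  rw [integral_add (h0.const_mul _).integrableOn (h1.const_mul _).integrableOn,
    integral_const_mul, integral_const_mul, setIntegral_Iic_stdNormalPDF_mul_id, ← stdNormalCDF,
    neg_div, stdNormalPDF_neg]
  ring

lemma setIntegral_Iic_sq_gaussianReal (m : ℝ) {s : ℝ} (hs : 0 < s) :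
    ∫ x in Set.Iic 0, x ^ 2 ∂gaussianReal m (.mk (s ^ 2) (sq_nonneg s)) =
      (m ^ 2 + s ^ 2) * stdNormalCDF (-m / s) - m * s * stdNormalPDF (m / s) := by
  have h0 := integrable_stdNormalPDF
  have h1 : Integrable (fun x ↦ stdNormalPDF x * x) := by
    simpa using integrable_stdNormalPDF_mul_pow 1
  have h2 := integrable_stdNormalPDF_mul_pow 2
  rw [setIntegral_Iic_gaussianReal m hs _ (by fun_prop)]
  have hexp (z : ℝ) : stdNormalPDF z * (m + s * z) ^ 2 =
      m ^ 2 * stdNormalPDF z + 2 * m * s * (stdNormalPDF z * z) +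
        s ^ 2 * (stdNormalPDF z * z ^ 2) := by ring
  simp_rw [hexp]
  have h01 : Integrable fun z ↦ m ^ 2 * stdNormalPDF z + 2 * m * s * (stdNormalPDF z * z) :=
    (h0.const_mul _).add (h1.const_mul _)
  rw [integral_add h01.integrableOn (h2.const_mul _).integrableOn,
    integral_add (h0.const_mul _).integrableOn (h1.const_mul _).integrableOn,
    integral_const_mul, integral_const_mul, integral_const_mul,
    setIntegral_Iic_stdNormalPDF_mul_id, setIntegral_Iic_stdNormalPDF_mul_sq, ← stdNormalCDF,
    neg_div, stdNormalPDF_neg]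
  field_simp
  ring

lemma integral_sq_of_map_eq_gaussianReal {Ω : Type*} [MeasurableSpace Ω] {μ : Measure Ω}
    {X : Ω → ℝ} (hX : Measurable X) {m : ℝ} {v : NNReal} (hlaw : μ.map X = gaussianReal m v) :
    ∫ ω, X ω ^ 2 ∂μ = m ^ 2 + v := by
  have h : ∫ x, x ^ 2 ∂gaussianReal m v = m ^ 2 + v := by
    have := variance_eq_sub (memLp_id_gaussianReal' (μ := m) (v := v) 2 (by simp))
    simp only [variance_id_gaussianReal, id_eq, Pi.pow_apply, integral_id_gaussianReal] at this
    linarith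
  rw [← h, ← hlaw, integral_map hX.aemeasurable (by fun_prop)]

/-- For independent real Gaussians, the difference is independent of the combination
weighted by the opposite variances. -/
lemma indepFun_sub_weighted_add {Ω : Type*} [MeasurableSpace Ω] {μ : Measure Ω}
    {X Y : Ω → ℝ} (hX : HasGaussianLaw X μ) (hY : HasGaussianLaw Y μ) (hindep : IndepFun X Y μ) :
    IndepFun (fun ω ↦ X ω - Y ω) (fun ω ↦ Var[Y; μ] * X ω + Var[X; μ] * Y ω) μ := by
  have := hX.isProbabilityMeasure
  have hX2 := hX.memLp_two
  have hY2 := hY.memLp_two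
  refine HasGaussianLaw.indepFun_of_covariance_eq_zero ?_ ?_
  · exact (hindep.hasGaussianLaw hX hY).map_fun
      ((ContinuousLinearMap.fst ℝ ℝ ℝ - ContinuousLinearMap.snd ℝ ℝ ℝ).prod
        (Var[Y; μ] • ContinuousLinearMap.fst ℝ ℝ ℝ + Var[X; μ] • ContinuousLinearMap.snd ℝ ℝ ℝ))
  · have hXY := hindep.covariance_eq_zero hX2 hY2
    have hYX := hXY
    rw [covariance_comm] at hYX
    change cov[X - Y, Var[Y; μ] • X + Var[X; μ] • Y; μ] = 0
    rw [covariance_add_right (hX2.sub hY2) (hX2.const_smul _) (hY2.const_smul _),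
      covariance_smul_right, covariance_smul_right, covariance_sub_left hX2 hY2 hX2,
      covariance_sub_left hX2 hY2 hY2, hXY, hYX, covariance_self hX.aemeasurable,
      covariance_self hY.aemeasurable]
    ring

/-- Second moment of the minimum of two independent normal random variables:
`E[min(X,Y)²] = (μ1² + σ1²) Φ(-μ̄/Δ) + (μ2² + σ2²) Φ(μ̄/Δ) - (μ1 + μ2) Δ φ(μ̄/Δ)`
where `μ̄ = μ1 - μ2` and `Δ = √(σ1² + σ2²)`. -/
theorem second_moment_min_of_indep_gaussians {Ω : Type*} [MeasurableSpace Ω]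
    (μ : Measure Ω) [IsProbabilityMeasure μ]
    (m1 m2 σ1 σ2 : ℝ) (hσ1 : 0 < σ1) (hσ2 : 0 < σ2)
    (X Y : Ω → ℝ) (hX : Measurable X) (hY : Measurable Y)
    (hXlaw : Measure.map X μ = gaussianReal m1 ⟨σ1 ^ 2, sq_nonneg σ1⟩)
    (hYlaw : Measure.map Y μ = gaussianReal m2 ⟨σ2 ^ 2, sq_nonneg σ2⟩)
    (hindep : IndepFun X Y μ) :
    ∫ ω, (min (X ω) (Y ω)) ^ 2 ∂μ =
      (m1 ^ 2 + σ1 ^ 2) * stdNormalCDF (-(m1 - m2) / Real.sqrt (σ1 ^ 2 + σ2 ^ 2)) +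
        (m2 ^ 2 + σ2 ^ 2) * stdNormalCDF ((m1 - m2) / Real.sqrt (σ1 ^ 2 + σ2 ^ 2)) -
        (m1 + m2) * Real.sqrt (σ1 ^ 2 + σ2 ^ 2) *
          stdNormalPDF ((m1 - m2) / Real.sqrt (σ1 ^ 2 + σ2 ^ 2)) := by
  replace hXlaw : μ.map X = gaussianReal m1 (.mk (σ1 ^ 2) (sq_nonneg σ1)) := hXlaw
  replace hYlaw : μ.map Y = gaussianReal m2 (.mk (σ2 ^ 2) (sq_nonneg σ2)) := hYlaw
  have hGX : HasGaussianLaw X μ := ⟨by rw [hXlaw]; infer_instance⟩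
  have hGY : HasGaussianLaw Y μ := ⟨by rw [hYlaw]; infer_instance⟩
  have hVX : Var[X; μ] = σ1 ^ 2 := by
    have h := variance_id_gaussianReal (μ := m1) (v := .mk (σ1 ^ 2) (sq_nonneg σ1))
    rwa [← hXlaw, variance_id_map hX.aemeasurable] at h
  have hVY : Var[Y; μ] = σ2 ^ 2 := by
    have h := variance_id_gaussianReal (μ := m2) (v := .mk (σ2 ^ 2) (sq_nonneg σ2))
    rwa [← hYlaw, variance_id_map hY.aemeasurable] at h
  have hEX : ∫ ω, X ω ∂μ = m1 := by
    rw [← integral_map (φ := X) (f := fun x ↦ x) hX.aemeasurable (by fun_prop), hXlaw,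
      integral_id_gaussianReal]
  have hEY : ∫ ω, Y ω ∂μ = m2 := by
    rw [← integral_map (φ := Y) (f := fun x ↦ x) hY.aemeasurable (by fun_prop), hYlaw,
      integral_id_gaussianReal]
  have hEY2 : ∫ ω, Y ω ^ 2 ∂μ = m2 ^ 2 + σ2 ^ 2 := integral_sq_of_map_eq_gaussianReal hY hYlaw
  set s := Real.sqrt (σ1 ^ 2 + σ2 ^ 2) with hs_def
  have hs : 0 < s := Real.sqrt_pos.2 (by positivity)
  have hs2 : s ^ 2 = σ1 ^ 2 + σ2 ^ 2 := Real.sq_sqrt (by positivity)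
  set D : Ω → ℝ := fun ω ↦ X ω - Y ω with hD_def
  set W : Ω → ℝ := fun ω ↦ σ2 ^ 2 * X ω + σ1 ^ 2 * Y ω with hW_def
  have hD : Measurable D := hX.sub hY
  have hDW : IndepFun D W μ := by
    have h := indepFun_sub_weighted_add hGX hGY hindep
    rwa [hVX, hVY] at h
  have hGD : HasGaussianLaw D μ := (hindep.hasGaussianLaw hGX hGY).fun_sub
  have hDlaw : μ.map D = gaussianReal (m1 - m2) (.mk (s ^ 2) (sq_nonneg s)) := by
    rw [hGD.map_eq_gaussianReal]
    congr 1
    · rw [hD_def, integral_sub hGX.integrable hGY.integrable, hEX, hEY]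
    · have hvar : Var[D; μ] = s ^ 2 := by
        rw [hD_def, variance_fun_sub hGX.memLp_two hGY.memLp_two,
          hindep.covariance_eq_zero hGX.memLp_two hGY.memLp_two, hVX, hVY, hs2]
        ring
      rw [hvar]
      exact Real.toNNReal_of_nonneg (sq_nonneg s)
  have hEW : ∫ ω, W ω ∂μ = σ2 ^ 2 * m1 + σ1 ^ 2 * m2 := by
    rw [hW_def, integral_add (hGX.integrable.const_mul _) (hGY.integrable.const_mul _),
      integral_const_mul, integral_const_mul, hEX, hEY]
  have hWint : Integrable W μ :=
    (hGX.integrable.const_mul _).add (hGY.integrable.const_mul _)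
  have hind (f : ℝ → ℝ) (hf : Measurable f) : ∫ ω, (Set.Iic 0).indicator f (D ω) ∂μ =
      ∫ x in Set.Iic 0, f x ∂gaussianReal (m1 - m2) (.mk (s ^ 2) (sq_nonneg s)) := by
    rw [← integral_indicator measurableSet_Iic, ← hDlaw,
      integral_map hD.aemeasurable (hf.indicator measurableSet_Iic).aestronglyMeasurable]
  set g : ℝ → ℝ := (Set.Iic 0).indicator fun x ↦ x with hg_def
  set h : ℝ → ℝ := (Set.Iic 0).indicator fun x ↦ x ^ 2 with hh_def
  have hg : Measurable g := measurable_id'.indicator measurableSet_Iic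
  have hgint : Integrable (fun ω ↦ g (D ω)) μ :=
    hGD.integrable.indicator (hD measurableSet_Iic)
  have hhint : Integrable (fun ω ↦ h (D ω)) μ :=
    hGD.memLp_two.integrable_sq.indicator (hD measurableSet_Iic)
  have hgD : IndepFun (fun ω ↦ g (D ω)) W μ := hDW.comp hg measurable_id
  have hEgW : ∫ ω, g (D ω) * W ω ∂μ = (∫ ω, g (D ω) ∂μ) * ∫ ω, W ω ∂μ :=
    hgD.integral_fun_mul_eq_mul_integral hgint.aestronglyMeasurable hWint.aestronglyMeasurable
  have hgWint : Integrable (fun ω ↦ g (D ω) * W ω) μ := hgD.integrable_mul hgint hWint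
  have hmin (ω : Ω) : min (X ω) (Y ω) ^ 2 =
      Y ω ^ 2 + (2 / s ^ 2 * (g (D ω) * W ω) + (σ1 ^ 2 - σ2 ^ 2) / s ^ 2 * h (D ω)) := by
    rcases le_or_gt (X ω) (Y ω) with hle | hlt
    · have hmem : D ω ∈ Set.Iic 0 := sub_nonpos.2 hle
      rw [min_eq_left hle, hg_def, hh_def, Set.indicator_of_mem hmem, Set.indicator_of_mem hmem]
      field_simp
      rw [hs2]
      simp only [hD_def, hW_def]
      ring
    · have hmem : D ω ∉ Set.Iic 0 := not_le.2 (sub_pos.2 hlt)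
      rw [min_eq_right hlt.le, hg_def, hh_def, Set.indicator_of_notMem hmem,
        Set.indicator_of_notMem hmem]
      ring
  have hcorr : Integrable (fun ω ↦ 2 / s ^ 2 * (g (D ω) * W ω) +
      (σ1 ^ 2 - σ2 ^ 2) / s ^ 2 * h (D ω)) μ :=
    (hgWint.const_mul _).add (hhint.const_mul _)
  simp_rw [hmin]
  rw [integral_add hGY.memLp_two.integrable_sq hcorr,
    integral_add (hgWint.const_mul _) (hhint.const_mul _), integral_const_mul,
    integral_const_mul, hEgW, hEW, hEY2, hg_def, hh_def, hind _ measurable_id',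
    hind _ (by fun_prop), setIntegral_Iic_id_gaussianReal _ hs,
    setIntegral_Iic_sq_gaussianReal _ hs]
  have hsum := stdNormalCDF_neg_add ((m1 - m2) / s)
  rw [← neg_div] at hsum
  rw [eq_sub_of_add_eq' hsum]
  field_simp
  rw [hs2]
  ring
end

section
/- For each integer M ≥ 2, let β*(M) = 1/(1 + √((M−1)(2M−1))) be the unique minimizer on (0,1) of the function β ↦ 1/β + (M−1)(2M−1)/(1−β). Then lim_{M→∞} 2M·β*(M) = √2. In other words, in a large ring of 2M nodes the asymptotically optimal probability for a node to transmit its own information is β̂* = √2/(2M), i.e. about √2 ≈ 1.41 times the uniform probability 1/(2M). -/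
open Filter

/-- The optimal source transmission probability in a ring of `2M` nodes:
`β*(M) = 1/(1 + √((M-1)(2M-1)))`. -/
noncomputable def betaStar (M : ℕ) : ℝ :=
  1 / (1 + Real.sqrt (((M : ℝ) - 1) * (2 * (M : ℝ) - 1)))

/-- Excess of the age `1/β + s²/(1-β)` over its minimum `(1+s)²`, as a square. -/
lemma one_div_add_sq_div_one_sub_eq (s : ℝ) {β : ℝ} (h0 : 0 < β) (h1 : β < 1) :
    1 / β + s ^ 2 / (1 - β) = (1 + s) ^ 2 + (1 - (1 + s) * β) ^ 2 / (β * (1 - β)) := by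
  have h2 : 1 - β ≠ 0 := by linarith
  field_simp
  ring

lemma one_div_one_add_mem_Ioo {s : ℝ} (hs : 0 < s) : 1 / (1 + s) ∈ Set.Ioo (0 : ℝ) 1 :=
  ⟨by positivity, by rw [div_lt_one (by positivity)]; linarith⟩

lemma one_div_add_sq_div_one_sub_lt {s : ℝ} (hs : 0 < s) {β : ℝ} (hβ : β ∈ Set.Ioo (0 : ℝ) 1)
    (hne : β ≠ 1 / (1 + s)) :
    1 / (1 / (1 + s)) + s ^ 2 / (1 - 1 / (1 + s)) < 1 / β + s ^ 2 / (1 - β) := by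
  have hs' : 1 + s ≠ 0 := by positivity
  have hmem := one_div_one_add_mem_Ioo hs
  rw [one_div_add_sq_div_one_sub_eq s hmem.1 hmem.2,
    one_div_add_sq_div_one_sub_eq s hβ.1 hβ.2, mul_one_div_cancel hs']
  have hsq : 0 < (1 - (1 + s) * β) ^ 2 := by
    refine sq_pos_of_ne_zero fun h => hne ?_
    rw [eq_div_iff hs']
    linarith
  have hpos : 0 < (1 - (1 + s) * β) ^ 2 / (β * (1 - β)) :=
    div_pos hsq (mul_pos hβ.1 (sub_pos.2 hβ.2))
  simpa using hpos

lemma two_mul_mul_betaStar_eq {M : ℕ} (hM : 0 < M) :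
    2 * (M : ℝ) * betaStar M =
      2 / ((M : ℝ)⁻¹ + Real.sqrt ((1 - (M : ℝ)⁻¹) * (2 - (M : ℝ)⁻¹))) := by
  have hM' : (0 : ℝ) < M := by exact_mod_cast hM
  have hfac : ((M : ℝ) - 1) * (2 * (M : ℝ) - 1) =
      (M : ℝ) ^ 2 * ((1 - (M : ℝ)⁻¹) * (2 - (M : ℝ)⁻¹)) := by
    field_simp
  rw [betaStar, hfac, Real.sqrt_mul (sq_nonneg _), Real.sqrt_sq hM'.le]
  have := Real.sqrt_nonneg ((1 - (M : ℝ)⁻¹) * (2 - (M : ℝ)⁻¹))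
  generalize Real.sqrt ((1 - (M : ℝ)⁻¹) * (2 - (M : ℝ)⁻¹)) = r at this ⊢
  have h1 : 1 + M * r ≠ 0 := by positivity
  field_simp

lemma tendsto_two_mul_mul_betaStar :
    Tendsto (fun M : ℕ => 2 * (M : ℝ) * betaStar M) atTop (nhds (Real.sqrt 2)) := by
  have hinv : Tendsto (fun M : ℕ => (M : ℝ)⁻¹) atTop (nhds 0) :=
    tendsto_inv_atTop_nhds_zero_nat
  have hlim := (tendsto_const_nhds (x := (2 : ℝ))).div
    (hinv.add ((hinv.const_sub 1).mul (hinv.const_sub 2)).sqrt) (by simp)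
  have hval : 2 / (0 + Real.sqrt ((1 - 0) * (2 - 0))) = Real.sqrt 2 := by
    simp [Real.div_sqrt]
  rw [hval] at hlim
  refine hlim.congr' ?_
  filter_upwards [eventually_gt_atTop 0] with M hM
  exact (two_mul_mul_betaStar_eq hM).symm

/-- For each `M ≥ 2`, `β*(M) = 1/(1+√((M-1)(2M-1)))` is the unique minimizer on `(0,1)` of
`β ↦ 1/β + (M-1)(2M-1)/(1-β)`, and `2M β*(M) → √2` as `M → ∞`: in a large ring of `2M`
nodes the asymptotically optimal own-transmission probability is `√2/(2M)`. -/
theorem limit_optimal_beta_ring :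
    (∀ M : ℕ, 2 ≤ M →
      betaStar M ∈ Set.Ioo (0 : ℝ) 1 ∧
      ∀ β ∈ Set.Ioo (0 : ℝ) 1, β ≠ betaStar M →
        1 / betaStar M + ((M : ℝ) - 1) * (2 * (M : ℝ) - 1) / (1 - betaStar M) <
          1 / β + ((M : ℝ) - 1) * (2 * (M : ℝ) - 1) / (1 - β)) ∧
    Tendsto (fun M : ℕ => 2 * (M : ℝ) * betaStar M) atTop (nhds (Real.sqrt 2)) := by
  refine ⟨fun M hM => ?_, tendsto_two_mul_mul_betaStar⟩
  have hM' : (2 : ℝ) ≤ M := by exact_mod_cast hM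
  have hpos : 0 < ((M : ℝ) - 1) * (2 * (M : ℝ) - 1) :=
    mul_pos (by linarith) (by linarith)
  have hs := Real.sqrt_pos.2 hpos
  refine ⟨one_div_one_add_mem_Ioo hs, fun β hβ hne => ?_⟩
  have hlt := one_div_add_sq_div_one_sub_lt hs hβ hne
  rwa [Real.sq_sqrt hpos.le] at hlt
end

section
/- Fix β ∈ (0,1) and r ∈ (0,1). Let P be the Markov transition kernel on the set S = {(i,j) : i, j positive integers, i ≤ j, j ≥ 2} which from state (i,j) moves to (1, i+1) with probability β·r, to (1, j+1) with probability β·(1−r), to (i+1, i+1) with probability (1−β)·r, and to (i+1, j+1) with probability (1−β)·(1−r). Then for any stationary probability distribution π of P, the first-coordinate marginal is geometric with parameter β: for every i ≥ 1, Σ_j π(i,j) = β(1−β)^{i−1}. -/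
/-- The state space of the 4-node ring: pairs `(i,j)` of positive integers with `i ≤ j`
and `j ≥ 2`, where `i` is the common age at the two neighbours of the source and `j` is
the age at the node opposite the source. -/
def RingState : Type := {s : ℕ+ × ℕ+ // s.1 ≤ s.2 ∧ 2 ≤ s.2}

/-- Transition kernel of the 4-node ring with source transmission probability `β` and
relay probability `r`: from `(i,j)` move to `(1, i+1)` w.p. `βr`, to `(1, j+1)` w.p.
`β(1-r)`, to `(i+1, i+1)` w.p. `(1-β)r`, and to `(i+1, j+1)` w.p. `(1-β)(1-r)`. -/
def ringKernel (β r : ℝ) (s t : RingState) : ℝ :=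
  (if t.val = (1, s.val.1 + 1) then β * r else 0) +
  (if t.val = (1, s.val.2 + 1) then β * (1 - r) else 0) +
  (if t.val = (s.val.1 + 1, s.val.1 + 1) then (1 - β) * r else 0) +
  (if t.val = (s.val.1 + 1, s.val.2 + 1) then (1 - β) * (1 - r) else 0)

/-- For any function `f`, the expectation of `f` after one step of the ring kernel from `s`. -/
theorem hasSum_ringKernel_mul (β r : ℝ) (s : RingState) (f : ℕ+ × ℕ+ → ℝ) :
    HasSum (fun t : RingState => ringKernel β r s t * f t.val)
      (β * r * f (1, s.val.1 + 1) + β * (1 - r) * f (1, s.val.2 + 1) +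
        (1 - β) * r * f (s.val.1 + 1, s.val.1 + 1) +
        (1 - β) * (1 - r) * f (s.val.1 + 1, s.val.2 + 1)) := by
  have point (p : ℕ+ × ℕ+) (hp : p.1 ≤ p.2 ∧ 2 ≤ p.2) (c : ℝ) :
      HasSum (fun t : RingState => (if t.val = p then c else 0) * f t.val) (c * f p) := by
    have h := hasSum_single (f := fun t : RingState => (if t.val = p then c else 0) * f t.val)
      ⟨p, hp⟩ fun t ht => by
        rw [if_neg fun h => ht (Subtype.ext h), zero_mul]
    simpa using h
  have two_le (a : ℕ+) : 2 ≤ a + 1 := add_le_add_left one_le 1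
  have h := (((point (1, s.val.1 + 1) ⟨one_le, two_le _⟩ (β * r)).add
    (point (1, s.val.2 + 1) ⟨one_le, two_le _⟩ (β * (1 - r)))).add
    (point (s.val.1 + 1, s.val.1 + 1) ⟨le_rfl, two_le _⟩ ((1 - β) * r))).add
    (point (s.val.1 + 1, s.val.2 + 1) ⟨add_le_add_left s.property.1 1, two_le _⟩
      ((1 - β) * (1 - r)))
  simpa only [ringKernel, add_mul] using h

theorem ringKernel_nonneg {β r : ℝ} (hβ : β ∈ Set.Ioo (0 : ℝ) 1) (hr : r ∈ Set.Ioo (0 : ℝ) 1)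
    (s t : RingState) : 0 ≤ ringKernel β r s t := by
  have h1 := hβ.1.le
  have h2 := sub_nonneg.2 hβ.2.le
  have h3 := hr.1.le
  have h4 := sub_nonneg.2 hr.2.le
  unfold ringKernel
  positivity

/-- The probability that the first coordinate equals `i` after one step. -/
theorem hasSum_ringKernel_fst_eq (β r : ℝ) (s : RingState) (i : ℕ+) :
    HasSum (fun t : RingState => ringKernel β r s t * if t.val.1 = i then 1 else 0)
      (β * (if 1 = i then 1 else 0) + (1 - β) * if s.val.1 + 1 = i then 1 else 0) := by
  convert hasSum_ringKernel_mul β r s (fun p => if p.1 = i then 1 else 0) using 1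
  ring

/-- The stationary balance equation for the first-coordinate marginal. -/
theorem tsum_fst_eq_of_stationary {β r : ℝ}
    (hβ : β ∈ Set.Ioo (0 : ℝ) 1) (hr : r ∈ Set.Ioo (0 : ℝ) 1)
    {π : RingState → ℝ} (hπnonneg : ∀ s, 0 ≤ π s) (hπ : Summable π)
    (hπstat : ∀ t : RingState, π t = ∑' s : RingState, π s * ringKernel β r s t) (i : ℕ+) :
    (∑' s : RingState, if s.val.1 = i then π s else 0) =
      ∑' s : RingState,
        π s * (β * (if 1 = i then 1 else 0) + (1 - β) * if s.val.1 + 1 = i then 1 else 0) := by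
  have row (s : RingState) := (hasSum_ringKernel_fst_eq β r s i).mul_left (π s)
  have hsum : Summable (Function.uncurry fun s t : RingState =>
      π s * (ringKernel β r s t * if t.val.1 = i then 1 else 0)) := by
    rw [summable_prod_of_nonneg]
    · refine ⟨fun s => (row s).summable, ?_⟩
      simp only [Function.uncurry_apply_pair, (row _).tsum_eq]
      have h1 := hβ.1.le
      have h2 := sub_nonneg.2 hβ.2.le
      refine hπ.of_nonneg_of_le (fun s => mul_nonneg (hπnonneg s) (by positivity)) fun s =>
        mul_le_of_le_one_right (hπnonneg s) ?_
      split_ifs <;> linarith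
    · rintro ⟨s, t⟩
      exact mul_nonneg (hπnonneg s) (mul_nonneg (ringKernel_nonneg hβ hr s t) (by positivity))
  calc (∑' t : RingState, if t.val.1 = i then π t else 0)
      = ∑' t : RingState, ∑' s : RingState,
          π s * (ringKernel β r s t * if t.val.1 = i then 1 else 0) := by
        refine tsum_congr fun t => ?_
        split_ifs
        · simpa using hπstat t
        · simp
    _ = ∑' s : RingState, ∑' t : RingState,
          π s * (ringKernel β r s t * if t.val.1 = i then 1 else 0) := hsum.tsum_comm
    _ = _ := tsum_congr fun s => (row s).tsum_eq

/-- For the 4-node ring kernel, the first-coordinate marginal of any stationary probability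
distribution is geometric with parameter `β`: `∑_j π(i,j) = β (1-β)^(i-1)` for all `i ≥ 1`. -/
theorem ring4_stationary_first_marginal_geometric (β r : ℝ)
    (hβ : β ∈ Set.Ioo (0 : ℝ) 1) (hr : r ∈ Set.Ioo (0 : ℝ) 1)
    (π : RingState → ℝ) (hπnonneg : ∀ s, 0 ≤ π s) (hπsum : ∑' s : RingState, π s = 1)
    (hπstat : ∀ t : RingState, π t = ∑' s : RingState, π s * ringKernel β r s t) :
    ∀ i : ℕ+,
      (∑' s : RingState, if s.val.1 = i then π s else 0) =
        β * (1 - β) ^ ((i : ℕ) - 1) := by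
  have hπ : Summable π := by
    by_contra h
    simp [tsum_eq_zero_of_not_summable h] at hπsum
  have balance := tsum_fst_eq_of_stationary hβ hr hπnonneg hπ hπstat
  intro i
  induction i using PNat.recOn with
  | one =>
    rw [balance]
    have ne_one (a : ℕ+) : a + 1 ≠ 1 := (PNat.lt_add_left 1 a).ne'
    simp [ne_one, tsum_mul_right, hπsum]
  | succ n ih =>
    have one_ne : (1 : ℕ+) ≠ n + 1 := (PNat.lt_add_left 1 n).ne
    have h : (fun s : RingState => π s * (β * (if (1 : ℕ+) = n + 1 then 1 else 0) +
        (1 - β) * if s.val.1 + 1 = n + 1 then 1 else 0)) =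
        fun s => (1 - β) * if s.val.1 = n then π s else 0 := by
      funext s
      simp only [if_neg one_ne, add_left_inj]
      split_ifs <;> ring
    obtain ⟨m, hm⟩ := Nat.exists_eq_succ_of_ne_zero n.ne_zero
    rw [balance, h, tsum_mul_left, ih, PNat.add_coe, hm]
    simp only [Nat.succ_eq_add_one, PNat.one_coe, Nat.add_sub_cancel]
    ring
end
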